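/- In the setup below, assume that X′_{prs} and X′_{qrs} are subracks of X. Then X′_{pqs} is not a subrack of X. -/

import Mathlib

/-- The set of points of `X` fixed by `φ_x^t`. -/
def fixedPts {X : Type} (φ : X → Equiv.Perm X) (x : X) (t : ℕ) : Set X :=
  {y : X | (φ x ^ t) y = y}

theorem Equiv.Perm.apply_mem_iff_of_mapsTo {X : Type*} [Finite X] {f : Equiv.Perm X} {S : Set X}
    (h : ∀ b ∈ S, f b ∈ S) (b : X) : f b ∈ S ↔ b ∈ S := by
  refine ⟨fun hb => ?_, h b⟩
  have himage : f '' S = S := Set.eq_of_subset_of_ncard_le (Set.image_subset_iff.2 h)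
    (Set.ncard_image_of_injective S f.injective).ge S.toFinite
  rwa [← himage, f.injective.mem_set_image] at hb

theorem Equiv.Perm.exists_mem_cycleType_pow_apply_eq_self {X : Type*} [Fintype X] [DecidableEq X]
    {f : Equiv.Perm X} {y : X} (h : f y ≠ y) : ∃ n ∈ f.cycleType, (f ^ n) y = y := by
  refine ⟨(f.cycleOf y).support.card, ?_, ?_⟩
  · rw [Equiv.Perm.cycleType_def, Multiset.mem_map]
    exact ⟨f.cycleOf y,
      Equiv.Perm.cycleOf_mem_cycleFactorsFinset_iff.2 (Equiv.Perm.mem_support.2 h), rfl⟩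
  · rw [← Equiv.Perm.cycleOf_pow_apply_self, ← (f.isCycle_cycleOf h).orderOf, pow_orderOf_eq_one,
      Equiv.Perm.one_apply]

theorem apply_mem_iff_of_mem_closure_range {X ι : Type*} {φ : ι → Equiv.Perm X} {S : Set X}
    (h : ∀ a b, φ a b ∈ S ↔ b ∈ S) {g : Equiv.Perm X}
    (hg : g ∈ Subgroup.closure (Set.range φ)) : ∀ b, g b ∈ S ↔ b ∈ S := by
  induction hg using Subgroup.closure_induction with
  | mem g hg => obtain ⟨a, rfl⟩ := hg; exact h a
  | one => simp
  | mul f g _ _ hf hg => intro b; rw [Equiv.Perm.mul_apply, hf, hg]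
  | inv g _ hg => intro b; rw [← hg, ← Equiv.Perm.mul_apply, mul_inv_cancel, Equiv.Perm.one_apply]

theorem fixedPts_one_subset {X : Type} (φ : X → Equiv.Perm X) (x : X) (t : ℕ) :
    fixedPts φ x 1 ⊆ fixedPts φ x t := by
  intro y hy
  rw [fixedPts, Set.mem_ofPred_eq, pow_one] at hy
  exact Equiv.Perm.pow_apply_eq_self_of_apply_eq_self hy t

theorem apply_mem_fixedPts {X : Type} {φ : X → Equiv.Perm X}
    (hφ : ∀ x y z, φ x (φ y z) = φ (φ x y) (φ x z)) {x a b : X} {t : ℕ}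
    (ha : a ∈ fixedPts φ x t) (hb : b ∈ fixedPts φ x t) : φ a b ∈ fixedPts φ x t := by
  have key : ∀ (n : ℕ) (y z : X), (φ x ^ n) (φ y z) = φ ((φ x ^ n) y) ((φ x ^ n) z) := by
    intro n
    induction n with
    | zero => simp
    | succ n ih => intro y z; rw [pow_succ', Equiv.Perm.mul_apply, ih, hφ]; rfl
  rw [fixedPts, Set.mem_ofPred_eq] at *
  rw [key, ha, hb]

/-- If `X_t \ X_1` is closed under the operation, its elements preserve `X_1`. -/
theorem apply_mem_fixedPts_one_of_closed {X : Type} [Finite X] {φ : X → Equiv.Perm X}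
    (hφ : ∀ x y z, φ x (φ y z) = φ (φ x y) (φ x z)) {x : X} {t : ℕ}
    (hcl : ∀ a ∈ fixedPts φ x t \ fixedPts φ x 1, ∀ b ∈ fixedPts φ x t \ fixedPts φ x 1,
      φ a b ∈ fixedPts φ x t \ fixedPts φ x 1) {a b : X}
    (ha : a ∈ fixedPts φ x t) (hb : b ∈ fixedPts φ x 1) : φ a b ∈ fixedPts φ x 1 := by
  by_cases ha' : a ∈ fixedPts φ x 1
  · exact apply_mem_fixedPts hφ ha' hb
  · by_contra hab
    have hab' : φ a b ∈ fixedPts φ x t \ fixedPts φ x 1 :=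
      ⟨apply_mem_fixedPts hφ ha (fixedPts_one_subset φ x t hb), hab⟩
    exact ((Equiv.Perm.apply_mem_iff_of_mapsTo (hcl a ⟨ha, ha'⟩) b).1 hab').2 hb

/-- In the setup, if `X′_{prs}` and `X′_{qrs}` are subracks of
`X`, then `X′_{pqs}` is not a subrack of `X`. -/
theorem stmt_10 (X : Type) [Fintype X] [DecidableEq X]
    (op : X → X → X)
    (φ : X → Equiv.Perm X)
    (hφ : ∀ x y : X, φ x y = op x y)
    (hsd : ∀ x y z : X, op x (op y z) = op (op x y) (op x z))
    (hq : ∀ x : X, op x x = x)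
    (hcr : ∀ x y : X, op y x = x → op x y = y)
    (hind : ∀ u v : X, ∃ g ∈ Subgroup.closure (Set.range φ), g u = v)
    (x : X) (p q r s : ℕ)
    (hp : 1 < p) (hq' : 1 < q) (hr : 1 < r) (hs : 0 < s)
    (hpq : Nat.Coprime p q) (hpr : Nat.Coprime p r) (hps : Nat.Coprime p s)
    (hqr : Nat.Coprime q r) (hqs : Nat.Coprime q s) (hrs : Nat.Coprime r s)
    (hcyc : (φ x).cycleType = {p * q * s, p * r * s, q * r * s})
    (hprs : (fixedPts φ x (p * r * s) \ fixedPts φ x 1).Nonempty ∧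
      ∀ a ∈ fixedPts φ x (p * r * s) \ fixedPts φ x 1,
        ∀ b ∈ fixedPts φ x (p * r * s) \ fixedPts φ x 1,
          op a b ∈ fixedPts φ x (p * r * s) \ fixedPts φ x 1)
    (hqrs : (fixedPts φ x (q * r * s) \ fixedPts φ x 1).Nonempty ∧
      ∀ a ∈ fixedPts φ x (q * r * s) \ fixedPts φ x 1,
        ∀ b ∈ fixedPts φ x (q * r * s) \ fixedPts φ x 1,
          op a b ∈ fixedPts φ x (q * r * s) \ fixedPts φ x 1) :
    ¬ ((fixedPts φ x (p * q * s) \ fixedPts φ x 1).Nonempty ∧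
      ∀ a ∈ fixedPts φ x (p * q * s) \ fixedPts φ x 1,
        ∀ b ∈ fixedPts φ x (p * q * s) \ fixedPts φ x 1,
          op a b ∈ fixedPts φ x (p * q * s) \ fixedPts φ x 1) := by
  rintro ⟨⟨y, -, hy⟩, hpqs⟩
  obtain ⟨-, hprs⟩ := hprs
  obtain ⟨-, hqrs⟩ := hqrs
  obtain rfl : op = fun x y => φ x y := funext₂ fun a b => (hφ a b).symm
  have hmaps : ∀ a, ∀ b ∈ fixedPts φ x 1, φ a b ∈ fixedPts φ x 1 := by
    intro a b hb
    by_cases ha : φ x a = a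
    · exact apply_mem_fixedPts hsd (by simpa [fixedPts] using ha) hb
    · obtain ⟨n, hn, han⟩ := Equiv.Perm.exists_mem_cycleType_pow_apply_eq_self ha
      rw [hcyc] at hn
      simp only [Multiset.insert_eq_cons, Multiset.mem_cons, Multiset.mem_singleton] at hn
      rcases hn with rfl | rfl | rfl
      · exact apply_mem_fixedPts_one_of_closed hsd hpqs han hb
      · exact apply_mem_fixedPts_one_of_closed hsd hprs han hb
      · exact apply_mem_fixedPts_one_of_closed hsd hqrs han hb
  obtain ⟨g, hg, rfl⟩ := hind x y
  refine hy ((apply_mem_iff_of_mem_closure_range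
    (fun a => Equiv.Perm.apply_mem_iff_of_mapsTo (hmaps a)) hg x).2 ?_)
  simpa [fixedPts] using hq x
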